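/- arXiv:1104.4893 — 5 statements merged into one kernel-verified Lean document; each statement's English description precedes it below -/
import Mathlib

section
/- Let 0 < α < 1/2 and B(x,y) := x^α y^α. For all x > 0, y > 0 and all u, v ∈ ℝ, the negative of the Hessian quadratic form of B satisfies: α(1−α)x^{α−2}y^{α}u² − 2α²x^{α−1}y^{α−1}uv + α(1−α)x^{α}y^{α−2}v² ≥ α(1−2α) x^α y^α (u²/x² + v²/y²). (The left-hand side equals −d²B(x,y)[(u,v),(u,v)], since ∂²B/∂x² = α(α−1)x^{α−2}y^α, ∂²B/∂x∂y = α²x^{α−1}y^{α−1}, ∂²B/∂y² = α(α−1)x^α y^{α−2}.) -/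
/-- the Hessian estimate for the Bellman function `B(x,y) = x^α y^α`:
for `0 < α < 1/2`, `x, y > 0` and all `u, v`,
`−d²B(x,y)[(u,v),(u,v)] ≥ α(1−2α) x^α y^α (u²/x² + v²/y²)`. -/
theorem bellman_hessian_bound (α : ℝ) (hα0 : 0 < α) (hα : α < 1 / 2)
    (x y u v : ℝ) (hx : 0 < x) (hy : 0 < y) :
    α * (1 - α) * x ^ (α - 2) * y ^ α * u ^ 2
        - 2 * α ^ 2 * x ^ (α - 1) * y ^ (α - 1) * u * v
        + α * (1 - α) * x ^ α * y ^ (α - 2) * v ^ 2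
      ≥ α * (1 - 2 * α) * x ^ α * y ^ α * (u ^ 2 / x ^ 2 + v ^ 2 / y ^ 2) := by
  have h2 : ∀ t : ℝ, 0 < t → t ^ (α - 2) = t ^ α / t ^ 2 := fun t ht => by
    rw [Real.rpow_sub ht, Real.rpow_two]
  have h1 : ∀ t : ℝ, 0 < t → t ^ (α - 1) = t ^ α / t := fun t ht => by
    rw [Real.rpow_sub ht, Real.rpow_one]
  rw [h2 x hx, h2 y hy, h1 x hx, h1 y hy]
  have hX : 0 < x ^ α := Real.rpow_pos_of_pos hx α
  have hY : 0 < y ^ α := Real.rpow_pos_of_pos hy α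
  generalize x ^ α = X at *
  generalize y ^ α = Y at *
  have key : 0 ≤ α ^ 2 * (X * Y) * (u / x - v / y) ^ 2 := by positivity
  have e : α * (1 - α) * (X / x ^ 2) * Y * u ^ 2
        - 2 * α ^ 2 * (X / x) * (Y / y) * u * v
        + α * (1 - α) * X * (Y / y ^ 2) * v ^ 2
      - α * (1 - 2 * α) * X * Y * (u ^ 2 / x ^ 2 + v ^ 2 / y ^ 2)
      = α ^ 2 * (X * Y) * (u / x - v / y) ^ 2 := by
    field_simp
    ring
  linarith
end

section
/- Let 0 < α < 1/2. There exists a constant c_α > 0 (depending only on α) such that for all x₁, x₂, y₁, y₂ > 0, setting x := (x₁+x₂)/2 and y := (y₁+y₂)/2, one has x^α y^α − (x₁^α y₁^α + x₂^α y₂^α)/2 ≥ c_α · x^α y^α · ((x₁−x)²/x² + (y₁−y)²/y²). -/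
/-- One-variable refined Bernoulli inequality. -/
lemma rpow_refined_bernoulli (b u : ℝ) (hb0 : 0 < b) (hb1 : b < 1) (hu0 : 0 < u) (hu2 : u < 2) :
    u ^ b ≤ 1 + b * (u - 1) - b * (1 - b) / 6 * (u - 1) ^ 2 := by
  obtain ⟨r, hr, rfl⟩ : ∃ r : ℝ, 0 < r ∧ u = r ^ 2 :=
    ⟨Real.sqrt u, Real.sqrt_pos.2 hu0, (Real.sq_sqrt hu0.le).symm⟩
  have hr1 : (r + 1) ^ 2 ≤ 6 := by nlinarith [sq_nonneg (r - 3 / 2)]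
  have hpow : (r ^ 2) ^ b = r ^ (2 * b) := by
    rw [← Real.rpow_natCast, ← Real.rpow_mul hr.le]; norm_num
  have key : (r ^ 2) ^ b ≤ 1 + b * (r ^ 2 - 1) - b * (1 - b) * (r - 1) ^ 2 := by
    have hsq := sq_nonneg (r - 1)
    rcases le_total b (1 / 2) with h | h
    · have h1 := Real.geom_mean_le_arith_mean2_weighted (w₁ := 2 * b) (w₂ := 1 - 2 * b)
        (by linarith) (by linarith) hr.le zero_le_one (by ring)
      rw [Real.one_rpow, mul_one, ← hpow] at h1
      nlinarith [mul_nonneg (mul_nonneg hb0.le hb0.le) hsq]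
    · have h1 := Real.geom_mean_le_arith_mean2_weighted (w₁ := 2 * b - 1) (w₂ := 2 - 2 * b)
        (by linarith) (by linarith) (sq_nonneg r) hr.le (by ring)
      have h2 : (r ^ 2) ^ (2 * b - 1) * r ^ (2 - 2 * b) = (r ^ 2) ^ b := by
        rw [hpow, ← Real.rpow_natCast, ← Real.rpow_mul hr.le, ← Real.rpow_add hr]
        congr 1; push_cast; ring
      rw [h2] at h1
      nlinarith [mul_nonneg (mul_nonneg (sub_nonneg.2 hb1.le) (sub_nonneg.2 hb1.le)) hsq]
  have h3 : (r ^ 2 - 1) ^ 2 ≤ 6 * (r - 1) ^ 2 := by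
    have := mul_le_mul_of_nonneg_right hr1 (sq_nonneg (r - 1))
    nlinarith
  have h4 := mul_le_mul_of_nonneg_left h3 (mul_nonneg hb0.le (sub_nonneg.2 hb1.le))
  nlinarith

/-- Normalized two-variable upper bound. -/
lemma rpow_mul_refined (a p q : ℝ) (ha0 : 0 < a) (ha : a < 1 / 2)
    (hp0 : 0 < p) (hp2 : p < 2) (hq0 : 0 < q) (hq2 : q < 2) :
    p ^ a * q ^ a ≤ 1 + a * ((p - 1) + (q - 1))
      - a * (1 - 2 * a) / 6 * ((p - 1) ^ 2 + (q - 1) ^ 2) := by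
  have h1 := rpow_refined_bernoulli (2 * a) p (by linarith) (by linarith) hp0 hp2
  have h2 := rpow_refined_bernoulli (2 * a) q (by linarith) (by linarith) hq0 hq2
  have e : ∀ u : ℝ, 0 < u → u ^ (2 * a) = (u ^ a) ^ 2 := by
    intro u hu
    rw [two_mul, Real.rpow_add hu, sq]
  rw [e p hp0] at h1
  rw [e q hq0] at h2
  nlinarith [sq_nonneg (p ^ a - q ^ a)]

/-- quantitative midpoint concavity of the Bellman function
`B(x,y) = x^α y^α` for `0 < α < 1/2`. -/
theorem bellman_midpoint_concavity (α : ℝ) (hα0 : 0 < α) (hα : α < 1 / 2) :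
    ∃ c : ℝ, 0 < c ∧
      ∀ x₁ x₂ y₁ y₂ : ℝ, 0 < x₁ → 0 < x₂ → 0 < y₁ → 0 < y₂ →
        ((x₁ + x₂) / 2) ^ α * ((y₁ + y₂) / 2) ^ α
            - (x₁ ^ α * y₁ ^ α + x₂ ^ α * y₂ ^ α) / 2
          ≥ c * (((x₁ + x₂) / 2) ^ α * ((y₁ + y₂) / 2) ^ α) *
              ((x₁ - (x₁ + x₂) / 2) ^ 2 / ((x₁ + x₂) / 2) ^ 2 +
                (y₁ - (y₁ + y₂) / 2) ^ 2 / ((y₁ + y₂) / 2) ^ 2) := by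
  refine ⟨α * (1 - 2 * α) / 6, by
    have : 0 < 1 - 2 * α := by linarith
    positivity, ?_⟩
  intro x₁ x₂ y₁ y₂ hx₁ hx₂ hy₁ hy₂
  obtain ⟨x, hx⟩ : ∃ x, x = (x₁ + x₂) / 2 := ⟨_, rfl⟩
  obtain ⟨y, hy⟩ : ∃ y, y = (y₁ + y₂) / 2 := ⟨_, rfl⟩
  rw [← hx, ← hy]
  have hx0 : 0 < x := by linarith
  have hy0 : 0 < y := by linarith
  obtain ⟨p, rfl⟩ : ∃ p, x₁ = x * p := ⟨x₁ / x, by field_simp⟩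
  obtain ⟨q, rfl⟩ : ∃ q, y₁ = y * q := ⟨y₁ / y, by field_simp⟩
  obtain rfl : x₂ = x * (2 - p) := by linarith
  obtain rfl : y₂ = y * (2 - q) := by linarith
  have hp := pos_of_mul_pos_right hx₁ hx0.le
  have hp' := pos_of_mul_pos_right hx₂ hx0.le
  have hq := pos_of_mul_pos_right hy₁ hy0.le
  have hq' := pos_of_mul_pos_right hy₂ hy0.le
  have h1 := rpow_mul_refined α p q hα0 hα hp (by linarith) hq (by linarith)
  have h2 := rpow_mul_refined α (2 - p) (2 - q) hα0 hα hp' (by linarith) hq' (by linarith)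
  rw [Real.mul_rpow hx0.le hp.le, Real.mul_rpow hx0.le hp'.le,
    Real.mul_rpow hy0.le hq.le, Real.mul_rpow hy0.le hq'.le]
  have e1 : (x * p - x) ^ 2 / x ^ 2 = (p - 1) ^ 2 := by field_simp
  have e2 : (y * q - y) ^ 2 / y ^ 2 = (q - 1) ^ 2 := by field_simp
  rw [e1, e2]
  have hK : 0 ≤ x ^ α * y ^ α := by positivity
  have h3 : (p ^ α * q ^ α + (2 - p) ^ α * (2 - q) ^ α) / 2
      ≤ 1 - α * (1 - 2 * α) / 6 * ((p - 1) ^ 2 + (q - 1) ^ 2) := by linarith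
  have h4 := mul_le_mul_of_nonneg_left h3 hK
  linarith
end

section
/- Let w be a weight on ℝ with finite dyadic A₂ constant Q := [w]_{A₂}, and let 0 < α < 1/2. For each dyadic interval J define μ_J := (⟨w⟩_J ⟨σ⟩_J)^α · ((Δ_J w)²/⟨w⟩_J² + (Δ_J σ)²/⟨σ⟩_J²) · |J|. Then there is a constant c_α depending only on α such that the family {μ_J} is a Carleson sequence with constant c_α Q^α: for every dyadic interval I, ∑_{J dyadic, J ⊆ I} μ_J ≤ c_α · Q^α · |I|. -/
open MeasureTheory Set
open scoped ENNReal Classical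

noncomputable section

/-- Length of a dyadic interval of generation `j`. -/
def dlen (j : ℤ) : ℝ := (2 : ℝ) ^ (-j)

/-- The dyadic interval `I_{j,k} = [k·2^{-j}, (k+1)·2^{-j})`. -/
def dyad (j k : ℤ) : Set ℝ := Set.Ico ((k : ℝ) * dlen j) (((k : ℝ) + 1) * dlen j)

/-- Average `⟨f⟩_I` of `f` over the dyadic interval `I = I_{j,k}`. -/
def avg (f : ℝ → ℝ) (j k : ℤ) : ℝ := (dlen j)⁻¹ * ∫ x in dyad j k, f x

/-- The Haar function `h_I` of the dyadic interval `I = I_{j,k}`. -/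
def haar (j k : ℤ) : ℝ → ℝ := fun x =>
  (Real.sqrt (dlen j))⁻¹ *
    ((dyad (j + 1) (2 * k + 1)).indicator (fun _ => (1 : ℝ)) x -
      (dyad (j + 1) (2 * k)).indicator (fun _ => (1 : ℝ)) x)

/-- `Δ_I w` for `I = I_{j,k}`. -/
def dOsc (w : ℝ → ℝ) (j k : ℤ) : ℝ :=
  |avg w (j + 1) (2 * k) - avg w j k| + |avg w (j + 1) (2 * k + 1) - avg w j k|

/-- The Carleson sequence `μ_J = (⟨w⟩_J⟨σ⟩_J)^α ((Δ_J w)²/⟨w⟩_J² + (Δ_J σ)²/⟨σ⟩_J²)|J|`,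
for `J = I_{j,k}` and `σ = w⁻¹`. -/
def muTerm (α : ℝ) (w : ℝ → ℝ) (j k : ℤ) : ℝ :=
  (avg w j k * avg (fun x => (w x)⁻¹) j k) ^ α *
    ((dOsc w j k) ^ 2 / (avg w j k) ^ 2 +
      (dOsc (fun x => (w x)⁻¹) j k) ^ 2 / (avg (fun x => (w x)⁻¹) j k) ^ 2) * dlen j

lemma phi_bound (β : ℝ) (h0 : 0 < β) (h1 : β < 1) (s : ℝ) (hs0 : 0 ≤ s) (hs : s < 1) :
    (1 + s) ^ β + (1 - s) ^ β ≤ 2 - β * (1 - β) / 2 * s ^ 2 := by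
  have key : AntitoneOn (fun s : ℝ => (1 + s) ^ β + (1 - s) ^ β + β * (1 - β) / 2 * s ^ 2)
      (Set.Ico 0 1) := by
    have hd : ∀ x ∈ Set.Ico (0:ℝ) 1, HasDerivAt
        (fun s : ℝ => (1 + s) ^ β + (1 - s) ^ β + β * (1 - β) / 2 * s ^ 2)
        (1 * β * (1 + x) ^ (β - 1) + (-1) * β * (1 - x) ^ (β - 1)
          + β * (1 - β) / 2 * (2 * x)) x := by
      intro x hx
      have a1 : HasDerivAt (fun s : ℝ => 1 + s) 1 x := by
        simpa using (hasDerivAt_id x).const_add 1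
      have a2 : HasDerivAt (fun s : ℝ => 1 - s) (-1) x := by
        simpa using (hasDerivAt_id x).const_sub 1
      have b1 := a1.rpow_const (p := β) (Or.inl (by have := hx.1; linarith))
      have b2 := a2.rpow_const (p := β) (Or.inl (by have := hx.2; linarith))
      have b3 : HasDerivAt (fun s : ℝ => β * (1 - β) / 2 * s ^ 2)
          (β * (1 - β) / 2 * (2 * x)) x := by
        simpa using (hasDerivAt_pow 2 x).const_mul (β * (1 - β) / 2)
      exact (b1.add b2).add b3
    refine antitoneOn_of_deriv_nonpos (convex_Ico 0 1)
      (fun x hx => (hd x hx).continuousAt.continuousWithinAt)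
      (fun x hx => (hd x (interior_subset hx)).differentiableAt.differentiableWithinAt) ?_
    intro x hx
    have hx := interior_subset hx
    rw [(hd x hx).deriv]
    have e1 : (1 + x) ^ (β - 1) ≤ 1 :=
      Real.rpow_le_one_of_one_le_of_nonpos (by linarith [hx.1]) (by linarith)
    have e2 : 1 + (1 - β) * x ≤ (1 - x) ^ (β - 1) := by
      have hb := rpow_one_add_le_one_add_mul_self (s := -x) (by linarith [hx.2])
        (p := 1 - β) (by linarith) (by linarith)
      rw [← sub_eq_add_neg] at hb
      have hpos : 0 < (1 - x) ^ (1 - β) := Real.rpow_pos_of_pos (by linarith [hx.2]) _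
      have e : β - 1 = -(1 - β) := by ring
      rw [e, Real.rpow_neg (by linarith [hx.2]), ← one_div, le_div_iff₀ hpos]
      have hu : 0 ≤ 1 + (1 - β) * x := by nlinarith [hx.1]
      nlinarith [sq_nonneg ((1 - β) * x)]
    nlinarith
  have := key (by simp) ⟨hs0, hs⟩ hs0
  norm_num at this
  linarith

lemma phi_bound' (β : ℝ) (h0 : 0 < β) (h1 : β < 1) (s : ℝ) (hs : |s| < 1) :
    (1 + s) ^ β + (1 - s) ^ β ≤ 2 - β * (1 - β) / 2 * s ^ 2 := by
  rcases le_total 0 s with h | h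
  · exact phi_bound β h0 h1 s h (by rwa [abs_of_nonneg h] at hs)
  · have := phi_bound β h0 h1 (-s) (by linarith) (by rwa [abs_of_nonpos h] at hs)
    have e : 1 - -s = 1 + s := by ring
    rw [e, neg_sq, ← sub_eq_add_neg] at this
    linarith

lemma amgm (α a b : ℝ) (ha : 0 < a) (hb : 0 < b) :
    (a * b) ^ α ≤ (a ^ (2 * α) + b ^ (2 * α)) / 2 := by
  rw [Real.mul_rpow ha.le hb.le, mul_comm 2 α, Real.rpow_mul ha.le, Real.rpow_mul hb.le]
  simp only [Real.rpow_two]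
  nlinarith [sq_nonneg (a ^ α - b ^ α)]

/-- Bellman inequality. -/
lemma bellman (α : ℝ) (h0 : 0 < α) (h1 : α < 1 / 2) (a b c d : ℝ)
    (ha : 0 < a) (hb : 0 < b) (hc : 0 < c) (hd : 0 < d) :
    ((a + b) / 2 * ((c + d) / 2)) ^ α * (((a - b) / (a + b)) ^ 2 + ((c - d) / (c + d)) ^ 2) *
        (α * (1 - 2 * α) / 4)
      ≤ ((a + b) / 2 * ((c + d) / 2)) ^ α - ((a * c) ^ α + (b * d) ^ α) / 2 := by
  set s := (a - b) / (a + b) with hs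
  set t := (c - d) / (c + d) with ht
  set x := (a + b) / 2 with hx
  set y := (c + d) / 2 with hy
  have hx0 : 0 < x := by positivity
  have hy0 : 0 < y := by positivity
  have e1 : a = x * (1 + s) := by rw [hx, hs]; field_simp; ring
  have e2 : b = x * (1 - s) := by rw [hx, hs]; field_simp; ring
  have e3 : c = y * (1 + t) := by rw [hy, ht]; field_simp; ring
  have e4 : d = y * (1 - t) := by rw [hy, ht]; field_simp; ring
  have p1 : 0 < 1 + s := pos_of_mul_pos_right (e1 ▸ ha) hx0.le
  have p2 : 0 < 1 - s := pos_of_mul_pos_right (e2 ▸ hb) hx0.le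
  have p3 : 0 < 1 + t := pos_of_mul_pos_right (e3 ▸ hc) hy0.le
  have p4 : 0 < 1 - t := pos_of_mul_pos_right (e4 ▸ hd) hy0.le
  have f1 : a * c = (x * y) * ((1 + s) * (1 + t)) := by rw [e1, e3]; ring
  have f2 : b * d = (x * y) * ((1 - s) * (1 - t)) := by rw [e2, e4]; ring
  rw [f1, f2, Real.mul_rpow (x := x * y) (y := (1 + s) * (1 + t)) (by positivity) (by positivity),
    Real.mul_rpow (x := x * y) (y := (1 - s) * (1 - t)) (by positivity) (by positivity)]
  have g1 := amgm α _ _ p1 p3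
  have g2 := amgm α _ _ p2 p4
  have g3 := phi_bound' (2 * α) (by linarith) (by linarith) s (abs_lt.2 ⟨by linarith, by linarith⟩)
  have g4 := phi_bound' (2 * α) (by linarith) (by linarith) t (abs_lt.2 ⟨by linarith, by linarith⟩)
  have hB : 0 < (x * y) ^ α := by positivity
  have : (s ^ 2 + t ^ 2) * (α * (1 - 2 * α) / 4) ≤
      1 - (((1 + s) * (1 + t)) ^ α + ((1 - s) * (1 - t)) ^ α) / 2 := by linarith
  have := mul_le_mul_of_nonneg_left this hB.le
  linarith

lemma dlen_pos (j : ℤ) : 0 < dlen j := by unfold dlen; positivity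

lemma dlen_succ (j : ℤ) : dlen j = 2 * dlen (j + 1) := by
  unfold dlen
  rw [neg_add, zpow_add₀ (by norm_num)]
  norm_num
  ring

lemma dyad_split (j k : ℤ) : dyad j k = dyad (j + 1) (2 * k) ∪ dyad (j + 1) (2 * k + 1) := by
  have := dlen_pos (j + 1)
  unfold dyad
  rw [dlen_succ j]
  push_cast
  rw [show (2 * (k : ℝ) + 1 + 1) * dlen (j + 1) = (k + 1) * (2 * dlen (j + 1)) by ring,
    Set.Ico_union_Ico_eq_Ico (by nlinarith) (by nlinarith)]
  congr 1
  ring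

lemma intOn {f : ℝ → ℝ} (hf : LocallyIntegrable f) (j k : ℤ) : IntegrableOn f (dyad j k) :=
  (hf.integrableOn_isCompact (isCompact_Icc)).mono_set Ico_subset_Icc_self

lemma avg_split {f : ℝ → ℝ} (hf : LocallyIntegrable f) (j k : ℤ) :
    avg f j k = (avg f (j + 1) (2 * k) + avg f (j + 1) (2 * k + 1)) / 2 := by
  have := dlen_pos (j + 1)
  unfold avg
  rw [dyad_split, setIntegral_union _ (show MeasurableSet (dyad (j + 1) (2 * k + 1)) from measurableSet_Ico)
    (intOn hf _ _) (intOn hf _ _), dlen_succ j]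
  · field_simp
  · unfold dyad
    rw [Set.disjoint_left]
    intro x hx hx'
    have h1 := hx.2
    have h2 := hx'.1
    push_cast at h1 h2
    linarith

lemma avg_pos {f : ℝ → ℝ} (hf : LocallyIntegrable f) (hp : ∀ x, 0 < f x) (j k : ℤ) :
    0 < avg f j k := by
  have := dlen_pos j
  unfold avg
  refine mul_pos (by positivity) ?_
  rw [setIntegral_pos_iff_support_of_nonneg_ae (Filter.Eventually.of_forall fun x => (hp x).le)
    (intOn hf j k)]
  have : Function.support f = Set.univ := by
    ext x; simp [(hp x).ne']
  rw [this, Set.univ_inter, dyad, Real.volume_Ico]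
  simp only [ENNReal.ofReal_pos]
  linarith

def Bel (α : ℝ) (w : ℝ → ℝ) (j k : ℤ) : ℝ :=
  (avg w j k * avg (fun x => (w x)⁻¹) j k) ^ α * dlen j

lemma osc_eq {f : ℝ → ℝ} (hf : LocallyIntegrable f) (j k : ℤ) :
    (dOsc f j k) ^ 2 = (avg f (j + 1) (2 * k) - avg f (j + 1) (2 * k + 1)) ^ 2 := by
  unfold dOsc
  rw [avg_split hf j k]
  generalize avg f (j + 1) (2 * k) = a
  generalize avg f (j + 1) (2 * k + 1) = b
  have e1 : a - (a + b) / 2 = (a - b) / 2 := by ring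
  have e2 : b - (a + b) / 2 = -((a - b) / 2) := by ring
  rw [e1, e2, abs_neg, ← two_mul, mul_pow, sq_abs]
  ring

lemma mu_step (α : ℝ) (h0 : 0 < α) (h1 : α < 1 / 2) {w : ℝ → ℝ} (hp : ∀ x, 0 < w x)
    (hw : LocallyIntegrable w) (hs : LocallyIntegrable (fun x => (w x)⁻¹)) (j k : ℤ) :
    muTerm α w j k * (α * (1 - 2 * α) / 16) ≤
      Bel α w j k - (Bel α w (j + 1) (2 * k) + Bel α w (j + 1) (2 * k + 1)) := by
  have hp' : ∀ x, 0 < (w x)⁻¹ := fun x => inv_pos.2 (hp x)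
  have ha := avg_pos hw hp (j + 1) (2 * k)
  have hb := avg_pos hw hp (j + 1) (2 * k + 1)
  have hc := avg_pos hs hp' (j + 1) (2 * k)
  have hd := avg_pos hs hp' (j + 1) (2 * k + 1)
  have hB := bellman α h0 h1 _ _ _ _ ha hb hc hd
  have hl := dlen_pos (j + 1)
  unfold muTerm Bel
  rw [osc_eq hw, osc_eq hs, avg_split hw j k, avg_split hs j k, dlen_succ j]
  generalize avg w (j + 1) (2 * k) = a at *
  generalize avg w (j + 1) (2 * k + 1) = b at *
  generalize avg (fun x => (w x)⁻¹) (j + 1) (2 * k) = c at *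
  generalize avg (fun x => (w x)⁻¹) (j + 1) (2 * k + 1) = d at *
  have e1 : (a - b) ^ 2 / ((a + b) / 2) ^ 2 = 4 * ((a - b) / (a + b)) ^ 2 := by
    field_simp; ring
  have e2 : (c - d) ^ 2 / ((c + d) / 2) ^ 2 = 4 * ((c - d) / (c + d)) ^ 2 := by
    field_simp; ring
  rw [e1, e2]
  have := mul_le_mul_of_nonneg_right hB (by positivity : 0 ≤ 2 * dlen (j + 1))
  linarith

lemma mu_nonneg (α : ℝ) {w : ℝ → ℝ} (hp : ∀ x, 0 < w x)
    (hw : LocallyIntegrable w) (hs : LocallyIntegrable (fun x => (w x)⁻¹)) (j k : ℤ) :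
    0 ≤ muTerm α w j k := by
  have ha := avg_pos hw hp j k
  have hb := avg_pos hs (fun x => inv_pos.2 (hp x)) j k
  have := dlen_pos j
  unfold muTerm
  positivity

lemma bel_nonneg (α : ℝ) {w : ℝ → ℝ} (hp : ∀ x, 0 < w x)
    (hw : LocallyIntegrable w) (hs : LocallyIntegrable (fun x => (w x)⁻¹)) (j k : ℤ) :
    0 ≤ Bel α w j k := by
  have ha := avg_pos hw hp j k
  have hb := avg_pos hs (fun x => inv_pos.2 (hp x)) j k
  have := dlen_pos j
  unfold Bel
  positivity

lemma sum_Ico_two (f : ℤ → ℝ) (a : ℤ) (n : ℕ) :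
    ∑ m ∈ Finset.Ico (2 * a) (2 * (a + n)), f m
      = ∑ m ∈ Finset.Ico a (a + n), (f (2 * m) + f (2 * m + 1)) := by
  induction n with
  | zero => simp
  | succ n ih =>
    have e1 : Finset.Ico a (a + (n + 1 : ℕ)) = insert (a + n) (Finset.Ico a (a + n)) := by
      ext; simp; omega
    have e2 : Finset.Ico (2 * a) (2 * (a + (n + 1 : ℕ))) =
        insert (2 * (a + n)) (insert (2 * (a + n) + 1) (Finset.Ico (2 * a) (2 * (a + n)))) := by
      ext; simp; omega
    rw [e1, e2, Finset.sum_insert (by simp), Finset.sum_insert (by simp),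
      Finset.sum_insert (by simp), ih]
    ring

def gen (k : ℤ) (n : ℕ) : Finset ℤ := Finset.Ico (k * 2 ^ n) ((k + 1) * 2 ^ n)

lemma sum_gen_succ (f : ℤ → ℝ) (k : ℤ) (n : ℕ) :
    ∑ m ∈ gen k (n + 1), f m = ∑ m ∈ gen k n, (f (2 * m) + f (2 * m + 1)) := by
  have := sum_Ico_two f (k * 2 ^ n) (2 ^ n)
  unfold gen
  convert this using 2 <;> congr 1 <;> push_cast <;> ring

lemma telescope (α : ℝ) (h0 : 0 < α) (h1 : α < 1 / 2) {w : ℝ → ℝ} (hp : ∀ x, 0 < w x)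
    (hw : LocallyIntegrable w) (hs : LocallyIntegrable (fun x => (w x)⁻¹)) (j k : ℤ) (N : ℕ) :
    (∑ n ∈ Finset.range N, ∑ m ∈ gen k n, muTerm α w (j + n) m) * (α * (1 - 2 * α) / 16)
      ≤ Bel α w j k - ∑ m ∈ gen k N, Bel α w (j + N) m := by
  induction N with
  | zero =>
    have e : gen k 0 = {k} := by
      ext m; simp [gen]; omega
    simp [e]
  | succ N ih =>
    rw [Finset.sum_range_succ, add_mul, sum_gen_succ]
    have : (∑ m ∈ gen k N, muTerm α w (j + N) m) * (α * (1 - 2 * α) / 16) ≤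
        ∑ m ∈ gen k N, Bel α w (j + N) m -
        ∑ m ∈ gen k N, (Bel α w (j + (N + 1 : ℕ)) (2 * m) + Bel α w (j + (N + 1 : ℕ)) (2 * m + 1)) := by
      rw [Finset.sum_mul, ← Finset.sum_sub_distrib]
      refine Finset.sum_le_sum fun m _ => ?_
      have := mu_step α h0 h1 hp hw hs (j + N) m
      push_cast
      rwa [← add_assoc]
    linarith

lemma subset_gen {j k j' k' : ℤ} (h : dyad j' k' ⊆ dyad j k) :
    ∃ n : ℕ, j' = j + n ∧ k' ∈ gen k n := by
  have p := dlen_pos j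
  have p' := dlen_pos j'
  unfold dyad at h
  rw [Set.Ico_subset_Ico_iff (by linarith)] at h
  obtain ⟨h1, h2⟩ := h
  have hl : dlen j' ≤ dlen j := by linarith
  unfold dlen at hl
  rw [zpow_le_zpow_iff_right₀ (by norm_num)] at hl
  obtain ⟨n, hn⟩ := Int.eq_ofNat_of_zero_le (show 0 ≤ j' - j by omega)
  have hj : j' = j + n := by omega
  refine ⟨n, hj, ?_⟩
  have e : dlen j = 2 ^ n * dlen j' := by
    unfold dlen
    rw [hj, ← zpow_natCast, ← zpow_add₀ (by norm_num)]
    congr 1; ring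
  rw [e, ← mul_assoc, mul_le_mul_iff_left₀ p'] at h1
  rw [e, ← mul_assoc, mul_le_mul_iff_left₀ p'] at h2
  have h1' : k * 2 ^ n ≤ k' := by exact_mod_cast h1
  have h2' : k' + 1 ≤ (k + 1) * 2 ^ n := by exact_mod_cast h2
  simp only [gen, Finset.mem_Ico]
  omega

/-- the sequence `{μ_J}` is Carleson with constant `c_α Q^α`,
where `Q = [w]_{A₂}`. -/
theorem mu_carleson (α : ℝ) (hα0 : 0 < α) (hα : α < 1 / 2) :
    ∃ c : ℝ, 0 < c ∧
      ∀ w : ℝ → ℝ, (∀ x, 0 < w x) → Measurable w →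
        LocallyIntegrable w → LocallyIntegrable (fun x => (w x)⁻¹) →
        ∀ Q : ℝ, 1 ≤ Q →
          (∀ j k : ℤ, avg w j k * avg (fun x => (w x)⁻¹) j k ≤ Q) →
          ∀ j k : ℤ,
            (∑' q : ℤ × ℤ,
                if dyad q.1 q.2 ⊆ dyad j k then ENNReal.ofReal (muTerm α w q.1 q.2) else 0)
              ≤ ENNReal.ofReal (c * Q ^ α * dlen j) := by
  have hc : 0 < α * (1 - 2 * α) / 16 := by
    have : 0 < 1 - 2 * α := by linarith
    positivity
  refine ⟨(α * (1 - 2 * α) / 16)⁻¹, inv_pos.2 hc, ?_⟩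
  intro w hp _ hw hs Q hQ hA j k
  set g : ℤ × ℤ → ℝ≥0∞ := fun q =>
    if dyad q.1 q.2 ⊆ dyad j k then ENNReal.ofReal (muTerm α w q.1 q.2) else 0 with hg
  have hz : ∀ j' k', g (j', k') ≠ 0 → ∃ n : ℕ, j' = j + n ∧ k' ∈ gen k n := by
    intro j' k' h
    by_cases hh : dyad j' k' ⊆ dyad j k
    · exact subset_gen hh
    · simp [hg, hh] at h
  have hle : ∀ j' k', g (j', k') ≤ ENNReal.ofReal (muTerm α w j' k') := by
    intro j' k'
    simp only [hg]
    split_ifs <;> simp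
  change ∑' q, g q ≤ _
  rw [ENNReal.tsum_prod']
  have inj : Function.Injective (fun n : ℕ => j + (n : ℤ)) := by
    intro a b h; simpa using h
  rw [← inj.tsum_eq (f := fun j' => ∑' k', g (j', k'))]
  · refine ENNReal.tsum_le_of_sum_range_le fun N => ?_
    have step : ∀ n : ℕ, ∑' k', g (j + n, k') ≤
        ENNReal.ofReal (∑ m ∈ gen k n, muTerm α w (j + n) m) := by
      intro n
      rw [tsum_eq_sum (s := gen k n), ENNReal.ofReal_sum_of_nonneg]
      · exact Finset.sum_le_sum fun m _ => hle _ _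
      · intro m _; exact mu_nonneg α hp hw hs _ _
      · intro m hm
        by_contra h
        obtain ⟨n', h1, h2⟩ := hz _ _ h
        have : n = n' := by omega
        subst this
        exact hm h2
    refine (Finset.sum_le_sum fun n _ => step n).trans ?_
    rw [← ENNReal.ofReal_sum_of_nonneg
      (fun n _ => Finset.sum_nonneg fun m _ => mu_nonneg α hp hw hs _ _)]
    refine ENNReal.ofReal_le_ofReal ?_
    have T := telescope α hα0 hα hp hw hs j k N
    have T2 : 0 ≤ ∑ m ∈ gen k N, Bel α w (j + N) m :=
      Finset.sum_nonneg fun m _ => bel_nonneg α hp hw hs _ _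
    have T3 : Bel α w j k ≤ Q ^ α * dlen j := by
      unfold Bel
      have ha := avg_pos hw hp j k
      have hb := avg_pos hs (fun x => inv_pos.2 (hp x)) j k
      have := dlen_pos j
      gcongr
      exact hA j k
    rw [mul_assoc, ← div_eq_inv_mul, le_div_iff₀ hc]
    linarith
  · intro j' hj'
    by_contra hn
    apply hj'
    simp only [ENNReal.tsum_eq_zero]
    intro k'
    by_contra h
    obtain ⟨n, h1, _⟩ := hz _ _ h
    exact hn ⟨n, h1.symm⟩
end
end

section
/- Let B > 0 and let {α_I}, indexed by the dyadic intervals of ℝ, be nonnegative numbers satisfying the Carleson condition: for every dyadic interval I, ∑_{J dyadic, J ⊆ I} α_J ≤ B·|I|. Then for every measurable function F : ℝ → [0,∞]: ∑_{I dyadic} (inf_{x ∈ I} F(x)) · α_I ≤ 2B ∫_ℝ F dx. -/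
open MeasureTheory Set
open scoped ENNReal Classical

noncomputable section

lemma dyad_nested {j j' k k' : ℤ} (hj : j ≤ j') :
    dyad j' k' ⊆ dyad j k ∨ Disjoint (dyad j' k') (dyad j k) := by
  by_cases hd : Disjoint (dyad j' k') (dyad j k)
  · exact Or.inr hd
  left
  rw [Set.not_disjoint_iff] at hd
  obtain ⟨x, ⟨h1, h2⟩, ⟨h3, h4⟩⟩ := hd
  obtain ⟨n, rfl⟩ := Int.le.dest hj
  have hp := dlen_pos (j + n)
  have hl : dlen j = ((2 ^ n : ℤ) : ℝ) * dlen (j + n) := by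
    unfold dlen
    push_cast
    rw [← zpow_natCast, ← zpow_add₀ (by norm_num)]
    congr 1
    ring
  rw [hl] at h3 h4
  have e1 : k * 2 ^ n < k' + 1 := by
    have : ((k * 2 ^ n : ℤ) : ℝ) * dlen (j + n) < ((k' + 1 : ℤ) : ℝ) * dlen (j + n) := by
      push_cast at *
      linarith
    exact_mod_cast lt_of_mul_lt_mul_right this hp.le
  have e2 : k' < (k + 1) * 2 ^ n := by
    have : ((k' : ℤ) : ℝ) * dlen (j + n) < (((k + 1) * 2 ^ n : ℤ) : ℝ) * dlen (j + n) := by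
      push_cast at *
      linarith
    exact_mod_cast lt_of_mul_lt_mul_right this hp.le
  have e1' : ((k * 2 ^ n : ℤ) : ℝ) ≤ (k' : ℝ) := by exact_mod_cast Int.lt_add_one_iff.mp e1
  have e2' : ((k' : ℝ) + 1) ≤ (((k + 1) * 2 ^ n : ℤ) : ℝ) := by
    exact_mod_cast Int.add_one_le_iff.mpr e2
  unfold dyad
  rw [hl]
  apply Set.Ico_subset_Ico
  · have := mul_le_mul_of_nonneg_right e1' hp.le
    push_cast at *
    linarith
  · have := mul_le_mul_of_nonneg_right e2' hp.le
    push_cast at *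
    linarith

lemma volume_dyad (j k : ℤ) : volume (dyad j k) = ENNReal.ofReal (dlen j) := by
  unfold dyad
  rw [Real.volume_Ico]
  congr 1
  ring

lemma sum_le_of_subset (B : ℝ) (hB : 0 < B) (a : ℤ → ℤ → ℝ)
    (hCar : ∀ j k : ℤ,
      (∑' q : ℤ × ℤ,
          if dyad q.1 q.2 ⊆ dyad j k then ENNReal.ofReal (a q.1 q.2) else 0)
        ≤ ENNReal.ofReal (B * dlen j)) (n : ℕ) :
    ∀ (T : Finset (ℤ × ℤ)) (E : Set ℝ), T.card ≤ n → (∀ q ∈ T, dyad q.1 q.2 ⊆ E) →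
      ∑ q ∈ T, ENNReal.ofReal (a q.1 q.2) ≤ ENNReal.ofReal B * volume E := by
  induction n with
  | zero =>
    intro T E hT _
    have : T = ∅ := Finset.card_eq_zero.mp (Nat.le_zero.mp hT)
    simp [this]
  | succ n ih =>
    intro T E hT hE
    rcases T.eq_empty_or_nonempty with rfl | hne
    · simp
    obtain ⟨p, hp, hmin⟩ := T.exists_min_image (fun q => q.1) hne
    rw [← Finset.sum_filter_add_sum_filter_not T (fun q => dyad q.1 q.2 ⊆ dyad p.1 p.2)]
    have hm : MeasurableSet (dyad p.1 p.2) := measurableSet_Ico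
    rw [← measure_inter_add_sdiff E hm, mul_add]
    apply add_le_add
    · rw [Set.inter_eq_self_of_subset_right (hE p hp), volume_dyad, ← ENNReal.ofReal_mul hB.le]
      refine le_trans ?_ (hCar p.1 p.2)
      rw [Finset.sum_filter]
      exact ENNReal.sum_le_tsum T
    · apply ih
      · have : (T.filter (fun q => ¬ dyad q.1 q.2 ⊆ dyad p.1 p.2)).card < T.card := by
          apply Finset.card_lt_card
          rw [Finset.filter_ssubset]
          exact ⟨p, hp, by simp⟩
        omega
      · intro q hq
        rw [Finset.mem_filter] at hq
        have hdj := (dyad_nested (k := p.2) (k' := q.2) (hmin q hq.1)).resolve_left hq.2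
        exact Set.subset_sdiff.mpr ⟨hE q hq.1, hdj⟩

lemma layer (c : ℝ≥0∞) :
    ∫⁻ t in Ioi (0 : ℝ), (if ENNReal.ofReal t < c then (1 : ℝ≥0∞) else 0) = c := by
  have hm : MeasurableSet {t : ℝ | ENNReal.ofReal t < c} :=
    measurableSet_lt ENNReal.measurable_ofReal measurable_const
  have : (fun t : ℝ => if ENNReal.ofReal t < c then (1 : ℝ≥0∞) else 0)
      = {t : ℝ | ENNReal.ofReal t < c}.indicator 1 := by
    ext t
    simp [Set.indicator_apply]
  rw [this, lintegral_indicator_one hm, Measure.restrict_apply hm]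
  rcases eq_or_ne c ⊤ with rfl | hc
  · simp
  · have : {t : ℝ | ENNReal.ofReal t < c} ∩ Ioi 0 = Ioo 0 c.toReal := by
      ext t
      simp only [mem_inter_iff, mem_ofPred_eq, mem_Ioi, mem_Ioo]
      constructor
      · rintro ⟨h1, h2⟩
        exact ⟨h2, (ENNReal.ofReal_lt_iff_lt_toReal h2.le hc).mp h1⟩
      · rintro ⟨h1, h2⟩
        exact ⟨(ENNReal.ofReal_lt_iff_lt_toReal h1.le hc).mpr h2, h1⟩
    rw [this, Real.volume_Ioo, sub_zero, ENNReal.ofReal_toReal hc]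

lemma layer_cake (F : ℝ → ℝ≥0∞) (hF : Measurable F) :
    ∫⁻ x, F x = ∫⁻ t in Ioi (0 : ℝ), volume {x | ENNReal.ofReal t < F x} := by
  calc ∫⁻ x, F x
      = ∫⁻ x, ∫⁻ t in Ioi (0 : ℝ), (if ENNReal.ofReal t < F x then (1 : ℝ≥0∞) else 0) := by
        simp_rw [layer]
    _ = ∫⁻ t in Ioi (0 : ℝ), ∫⁻ x, (if ENNReal.ofReal t < F x then (1 : ℝ≥0∞) else 0) := by
        apply lintegral_lintegral_swap
        apply Measurable.aemeasurable
        apply Measurable.ite _ measurable_const measurable_const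
        exact measurableSet_lt (ENNReal.measurable_ofReal.comp measurable_snd)
          (hF.comp measurable_fst)
    _ = _ := by
        congr 1
        ext t
        have hm : MeasurableSet {x : ℝ | ENNReal.ofReal t < F x} :=
          measurableSet_lt measurable_const hF
        rw [← lintegral_indicator_one hm]
        congr 1
        ext x
        simp [Set.indicator_apply]

/-- dyadic Carleson embedding with infima:
if `∑_{J ⊆ I} α_J ≤ B|I|` for every dyadic `I`, then
`∑_I (inf_I F) α_I ≤ 2B ∫ F dx` for every measurable `F : ℝ → [0,∞]`. -/
theorem carleson_embedding_inf (B : ℝ) (hB : 0 < B)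
    (a : ℤ → ℤ → ℝ) (ha : ∀ j k, 0 ≤ a j k)
    (hCar : ∀ j k : ℤ,
      (∑' q : ℤ × ℤ,
          if dyad q.1 q.2 ⊆ dyad j k then ENNReal.ofReal (a q.1 q.2) else 0)
        ≤ ENNReal.ofReal (B * dlen j))
    (F : ℝ → ℝ≥0∞) (hF : Measurable F) :
    (∑' q : ℤ × ℤ, (⨅ x ∈ dyad q.1 q.2, F x) * ENNReal.ofReal (a q.1 q.2))
      ≤ 2 * ENNReal.ofReal B * ∫⁻ x, F x := by
  have key : (∑' q : ℤ × ℤ, (⨅ x ∈ dyad q.1 q.2, F x) * ENNReal.ofReal (a q.1 q.2))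
      ≤ ENNReal.ofReal B * ∫⁻ x, F x := by
    apply ENNReal.summable.tsum_le_of_sum_le
    intro S
    have hmeas : ∀ c : ℝ≥0∞, Measurable
        (fun t : ℝ => if ENNReal.ofReal t < c then (1 : ℝ≥0∞) else 0) := fun c =>
      Measurable.ite (measurableSet_lt ENNReal.measurable_ofReal measurable_const)
        measurable_const measurable_const
    calc ∑ q ∈ S, (⨅ x ∈ dyad q.1 q.2, F x) * ENNReal.ofReal (a q.1 q.2)
        = ∑ q ∈ S, ∫⁻ t in Ioi (0 : ℝ),
            (if ENNReal.ofReal t < (⨅ x ∈ dyad q.1 q.2, F x) then (1 : ℝ≥0∞) else 0)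
              * ENNReal.ofReal (a q.1 q.2) := by
          refine Finset.sum_congr rfl fun q _ => ?_
          rw [lintegral_mul_const _ (hmeas _), layer]
      _ = ∫⁻ t in Ioi (0 : ℝ), ∑ q ∈ S,
            (if ENNReal.ofReal t < (⨅ x ∈ dyad q.1 q.2, F x) then (1 : ℝ≥0∞) else 0)
              * ENNReal.ofReal (a q.1 q.2) := by
          rw [lintegral_finsetSum]
          exact fun q _ => (hmeas _).mul_const _
      _ ≤ ∫⁻ t in Ioi (0 : ℝ), ENNReal.ofReal B * volume {x | ENNReal.ofReal t < F x} := by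
          apply lintegral_mono
          intro t
          simp only [ite_mul, one_mul, zero_mul]
          rw [← Finset.sum_filter]
          apply sum_le_of_subset B hB a hCar _ _ _ le_rfl
          intro q hq x hx
          exact lt_of_lt_of_le (Finset.mem_filter.mp hq).2 (iInf₂_le x hx)
      _ = ENNReal.ofReal B * ∫⁻ x, F x := by
          rw [layer_cake F hF, lintegral_const_mul' _ _ ENNReal.ofReal_ne_top]
  refine key.trans ?_
  rw [mul_assoc, two_mul]
  exact le_self_add
end
end

section
/- Let w be a weight on ℝ with finite dyadic A₂ constant [w]_{A₂}, σ := 1/w, and m, n ≥ 0 integers. Suppose that for each dyadic interval I we are given h_I^w supported on I, constant on each half of I, with ∫ h_I^w w dx = 0 and ∫ (h_I^w)² w dx = 1, and similarly h_J^σ with w replaced by σ. For a dyadic interval L set S_L(φw) := ∑_{I ⊆ L, |I| = 2^{−m}|L|} |∫ φ h_I^w w dx| √⟨w⟩_I √(|I|/|L|) and S_L(ψσ) := ∑_{J ⊆ L, |J| = 2^{−n}|L|} |∫ ψ h_J^σ σ dx| √⟨σ⟩_J √(|J|/|L|). Then there is an absolute constant C such that for all φ ∈ L²(w dx), ψ ∈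 L²(σ dx): ∑_{L dyadic} S_L(φw) S_L(ψσ) ≤ C [w]_{A₂}^{1/2} ‖φ‖_{L²(w)} ‖ψ‖_{L²(σ)}. -/
open MeasureTheory Set
open scoped ENNReal Classical

noncomputable section

/-- `S_L(φv) = ∑_{I ⊆ L, |I| = 2^{-m}|L|} |(φv, h_I^v)| √⟨v⟩_I √(|I|/|L|)`,
for `L = I_{j,k}`, a weight `v`, and a family `hV` of weighted Haar functions. -/
def SL (v : ℝ → ℝ) (hV : ℤ → ℤ → ℝ → ℝ) (m : ℕ) (φ : ℝ → ℝ) (j k : ℤ) : ℝ :=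
  ∑ ki ∈ Finset.Ico ((2 : ℤ) ^ m * k) ((2 : ℤ) ^ m * (k + 1)),
    |∫ x, φ x * hV (j + m) ki x * v x| * Real.sqrt (avg v (j + m) ki) *
      Real.sqrt (dlen (j + m) / dlen j)

lemma dlen_add (j : ℤ) (m : ℕ) : dlen j = 2 ^ m * dlen (j + m) := by
  unfold dlen
  rw [← zpow_natCast, ← zpow_add₀ (by norm_num)]
  congr 1; ring

lemma mem_dyad_iff {j k : ℤ} {x : ℝ} : x ∈ dyad j k ↔ ⌊x / dlen j⌋ = k := by
  unfold dyad
  rw [Int.floor_eq_iff, le_div_iff₀ (dlen_pos j), div_lt_iff₀ (dlen_pos j), Set.mem_Ico]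

lemma dyad_nest {j i : ℤ} {m : ℕ} {x : ℝ} (h : x ∈ dyad (j + m) i) :
    x ∈ dyad j (i / 2 ^ m) := by
  rw [mem_dyad_iff] at h ⊢
  subst h
  have : x / dlen j = (x / dlen (j + m)) / ((2 ^ m : ℕ) : ℝ) := by
    rw [dlen_add j m]; push_cast
    have := dlen_pos (j + m)
    field_simp
  rw [this, Int.floor_div_natCast]
  push_cast; rfl

lemma dyad_unique {j k l : ℤ} {x : ℝ} (h : x ∈ dyad j k) (h' : x ∈ dyad j l) : k = l := by
  rw [mem_dyad_iff] at h h'; rw [← h, h']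

lemma measurableSet_dyad (j k : ℤ) : MeasurableSet (dyad j k) := measurableSet_Ico

lemma ediv_eq_of_mem {m : ℕ} {k i : ℤ}
    (h : i ∈ Finset.Ico ((2 : ℤ) ^ m * k) ((2 : ℤ) ^ m * (k + 1))) : i / 2 ^ m = k := by
  rw [Finset.mem_Ico] at h
  have hp : (0 : ℤ) < 2 ^ m := by positivity
  apply le_antisymm
  · have : i / 2 ^ m < k + 1 := by rw [Int.ediv_lt_iff_lt_mul hp]; linarith [h.2]
    omega
  · rw [Int.le_ediv_iff_mul_le hp]; linarith [h.1]

lemma integrableOn_dyad {v : ℝ → ℝ} (hv : LocallyIntegrable v) (j k : ℤ) :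
    IntegrableOn v (dyad j k) :=
  (hv.integrableOn_isCompact isCompact_Icc).mono_set Ico_subset_Icc_self

lemma avg_nonneg' {v : ℝ → ℝ} (hv : ∀ x, 0 < v x) (j k : ℤ) : 0 ≤ avg v j k :=
  mul_nonneg (inv_nonneg.2 (dlen_pos j).le) (integral_nonneg fun x => (hv x).le)

lemma sum_avg_le {v : ℝ → ℝ} (h0 : ∀ x, 0 < v x) (hv : LocallyIntegrable v) (m : ℕ) (j k : ℤ) :
    ∑ i ∈ Finset.Ico ((2 : ℤ) ^ m * k) ((2 : ℤ) ^ m * (k + 1)),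
      avg v (j + m) i * (dlen (j + m) / dlen j) ≤ avg v j k := by
  have h1 : ∀ i, avg v (j + m) i * (dlen (j + m) / dlen j)
      = (dlen j)⁻¹ * ∫ x in dyad (j + m) i, v x := by
    intro i
    unfold avg
    have := dlen_pos (j + m)
    have := dlen_pos j
    field_simp
  simp only [h1]
  rw [← Finset.mul_sum, ← integral_biUnion_finset]
  · unfold avg
    apply mul_le_mul_of_nonneg_left _ (inv_nonneg.2 (dlen_pos j).le)
    apply setIntegral_mono_set (integrableOn_dyad hv j k)
    · exact Filter.Eventually.of_forall fun x => (h0 x).le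
    · apply LE.le.eventuallyLE
      intro x hx
      simp only [Set.mem_iUnion] at hx
      obtain ⟨i, hi, hx⟩ := hx
      have := dyad_nest hx
      rwa [ediv_eq_of_mem hi] at this
  · exact fun i _ => measurableSet_dyad _ _
  · intro i _ i' _ hne
    exact Set.disjoint_left.2 fun x hx hx' => hne (dyad_unique hx hx')
  · exact fun i _ => integrableOn_dyad hv _ _

lemma SL_nonneg (v : ℝ → ℝ) (hV : ℤ → ℤ → ℝ → ℝ) (m : ℕ) (φ : ℝ → ℝ) (j k : ℤ) :
    0 ≤ SL v hV m φ j k := Finset.sum_nonneg fun i _ => by positivity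

/-- Square of the local coefficient sum. -/
def AL (v : ℝ → ℝ) (hV : ℤ → ℤ → ℝ → ℝ) (m : ℕ) (φ : ℝ → ℝ) (j k : ℤ) : ℝ :=
  ∑ ki ∈ Finset.Ico ((2 : ℤ) ^ m * k) ((2 : ℤ) ^ m * (k + 1)),
    (∫ x, φ x * hV (j + m) ki x * v x) ^ 2

lemma SL_le {v : ℝ → ℝ} (h0 : ∀ x, 0 < v x) (hv : LocallyIntegrable v)
    (hV : ℤ → ℤ → ℝ → ℝ) (m : ℕ) (φ : ℝ → ℝ) (j k : ℤ) :
    SL v hV m φ j k ≤ √(AL v hV m φ j k) * √(avg v j k) := by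
  unfold SL AL
  simp only [mul_assoc]
  refine (Real.sum_mul_le_sqrt_mul_sqrt _ _ _).trans ?_
  simp only [sq_abs]
  apply mul_le_mul_of_nonneg_left _ (Real.sqrt_nonneg _)
  apply Real.sqrt_le_sqrt
  refine le_trans (le_of_eq ?_) (sum_avg_le h0 hv m j k)
  apply Finset.sum_congr rfl
  intro i _
  rw [mul_pow, Real.sq_sqrt (avg_nonneg' h0 _ _), Real.sq_sqrt]
  exact div_nonneg (dlen_pos _).le (dlen_pos _).le

lemma haar_const {H : ℤ → ℤ → ℝ → ℝ} (hs : ∀ j k : ℤ, ∀ x ∉ dyad j k, H j k x = 0)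
    (hl : ∀ j k : ℤ, ∀ x ∈ dyad (j + 1) (2 * k), ∀ y ∈ dyad (j + 1) (2 * k), H j k x = H j k y)
    (hr : ∀ j k : ℤ, ∀ x ∈ dyad (j + 1) (2 * k + 1), ∀ y ∈ dyad (j + 1) (2 * k + 1),
          H j k x = H j k y) (j k j' k' : ℤ) (hj : j < j') :
    ∃ c, ∀ x ∈ dyad j' k', H j k x = c := by
  obtain ⟨d, hd⟩ := Int.le.dest (show j + 1 ≤ j' from hj)
  subst hd
  set q := k' / 2 ^ d
  have hq : ∀ x ∈ dyad (j + 1 + d) k', x ∈ dyad (j + 1) q := fun x hx => dyad_nest hx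
  have hne : (dyad (j + 1 + d) k').Nonempty := by
    unfold dyad
    rw [Set.nonempty_Ico]
    have := dlen_pos (j + 1 + d)
    nlinarith
  obtain ⟨y, hy⟩ := hne
  refine ⟨H j k y, fun x hx => ?_⟩
  have hx := hq x hx
  have hy := hq y hy
  by_cases h1 : q = 2 * k
  · rw [h1] at hx hy; exact hl j k x hx y hy
  by_cases h2 : q = 2 * k + 1
  · rw [h2] at hx hy; exact hr j k x hx y hy
  have key : ∀ z ∈ dyad (j + 1) q, H j k z = 0 := by
    intro z hz
    apply hs
    intro hz'
    have := dyad_nest (m := 1) (j := j) (i := q) (by simpa using hz)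
    have := dyad_unique hz' this
    omega
  rw [key x hx, key y hy]

lemma haar_orth_lt {v : ℝ → ℝ} {H : ℤ → ℤ → ℝ → ℝ}
    (hs : ∀ j k : ℤ, ∀ x ∉ dyad j k, H j k x = 0)
    (hl : ∀ j k : ℤ, ∀ x ∈ dyad (j + 1) (2 * k), ∀ y ∈ dyad (j + 1) (2 * k), H j k x = H j k y)
    (hr : ∀ j k : ℤ, ∀ x ∈ dyad (j + 1) (2 * k + 1), ∀ y ∈ dyad (j + 1) (2 * k + 1),
          H j k x = H j k y)
    (hz : ∀ j k : ℤ, (∫ x, H j k x * v x) = 0) (j k j' k' : ℤ) (hj : j < j') :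
    ∫ x, H j k x * H j' k' x * v x = 0 := by
  obtain ⟨c, hc⟩ := haar_const hs hl hr j k j' k' hj
  have : ∀ x, H j k x * H j' k' x * v x = c * (H j' k' x * v x) := by
    intro x
    by_cases hx : x ∈ dyad j' k'
    · rw [hc x hx, mul_assoc]
    · rw [hs _ _ x hx]; ring
  simp only [this]
  rw [integral_const_mul, hz, mul_zero]

lemma haar_orth {v : ℝ → ℝ} {H : ℤ → ℤ → ℝ → ℝ}
    (hs : ∀ j k : ℤ, ∀ x ∉ dyad j k, H j k x = 0)
    (hl : ∀ j k : ℤ, ∀ x ∈ dyad (j + 1) (2 * k), ∀ y ∈ dyad (j + 1) (2 * k), H j k x = H j k y)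
    (hr : ∀ j k : ℤ, ∀ x ∈ dyad (j + 1) (2 * k + 1), ∀ y ∈ dyad (j + 1) (2 * k + 1),
          H j k x = H j k y)
    (hz : ∀ j k : ℤ, (∫ x, H j k x * v x) = 0) (p q : ℤ × ℤ) (hpq : p ≠ q) :
    ∫ x, H p.1 p.2 x * H q.1 q.2 x * v x = 0 := by
  obtain ⟨j, k⟩ := p
  obtain ⟨j', k'⟩ := q
  rcases lt_trichotomy j j' with h | h | h
  · exact haar_orth_lt hs hl hr hz _ _ _ _ h
  · subst h
    have hk : k ≠ k' := fun h => hpq (by rw [h])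
    have : ∀ x, H j k x * H j k' x * v x = 0 := by
      intro x
      by_cases hx : x ∈ dyad j k
      · rw [hs j k' x (fun hx' => hk (dyad_unique hx hx'))]; ring
      · rw [hs _ _ x hx]; ring
    simp [this]
  · have := haar_orth_lt hs hl hr hz j' k' j k h
    simpa only [mul_comm (H j k _)] using this

lemma bessel {v : ℝ → ℝ} (h0 : ∀ x, 0 < v x) (hm : Measurable v) {H : ℤ → ℤ → ℝ → ℝ}
    (hH : ∀ j k, Measurable (H j k))
    (hs : ∀ j k : ℤ, ∀ x ∉ dyad j k, H j k x = 0)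
    (hl : ∀ j k : ℤ, ∀ x ∈ dyad (j + 1) (2 * k), ∀ y ∈ dyad (j + 1) (2 * k), H j k x = H j k y)
    (hr : ∀ j k : ℤ, ∀ x ∈ dyad (j + 1) (2 * k + 1), ∀ y ∈ dyad (j + 1) (2 * k + 1),
          H j k x = H j k y)
    (hz : ∀ j k : ℤ, (∫ x, H j k x * v x) = 0)
    (h1 : ∀ j k : ℤ, (∫ x, (H j k x) ^ 2 * v x) = 1)
    {φ : ℝ → ℝ} (hφ : Measurable φ) (hi : Integrable (fun x => (φ x) ^ 2 * v x))
    (t : Finset (ℤ × ℤ)) :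
    ∑ p ∈ t, (∫ x, φ x * H p.1 p.2 x * v x) ^ 2 ≤ ∫ x, (φ x) ^ 2 * v x := by
  have hsq : ∀ x, √(v x) * √(v x) = v x := fun x => Real.mul_self_sqrt (h0 x).le
  have mem : ∀ f : ℝ → ℝ, Measurable f → Integrable (fun x => (f x) ^ 2 * v x) →
      MemLp (fun x => f x * √(v x)) 2 volume := by
    intro f hf hfi
    have hmeas : Measurable (fun x => f x * √(v x)) := hf.mul hm.sqrt
    rw [memLp_two_iff_integrable_sq hmeas.aestronglyMeasurable]
    refine hfi.congr (Filter.Eventually.of_forall fun x => ?_)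
    simp only [mul_pow, Real.sq_sqrt (h0 x).le]
  have hHint : ∀ p : ℤ × ℤ, Integrable (fun x => (H p.1 p.2 x) ^ 2 * v x) := by
    intro p
    by_contra hcon
    have := h1 p.1 p.2
    rw [integral_undef hcon] at this
    exact zero_ne_one this
  let e : ℤ × ℤ → Lp ℝ 2 (volume : Measure ℝ) := fun p => (mem _ (hH p.1 p.2) (hHint p)).toLp
  let F : Lp ℝ 2 (volume : Measure ℝ) := (mem _ hφ hi).toLp
  have inn : ∀ (f g : ℝ → ℝ) (hf : MemLp (fun x => f x * √(v x)) 2 volume)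
      (hg : MemLp (fun x => g x * √(v x)) 2 volume),
      inner ℝ hf.toLp hg.toLp = ∫ x, g x * f x * v x := by
    intro f g hf hg
    rw [L2.inner_def]
    apply integral_congr_ae
    filter_upwards [hf.coeFn_toLp, hg.coeFn_toLp] with x hx hy
    rw [hx, hy]
    have hin : ∀ a b : ℝ, inner ℝ a b = b * a := fun a b => by
      simp [RCLike.inner_apply]
    rw [hin]
    calc g x * √(v x) * (f x * √(v x)) = g x * f x * (√(v x) * √(v x)) := by ring
      _ = _ := by rw [hsq x]
  have ho : Orthonormal ℝ e := by
    rw [orthonormal_iff_ite]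
    intro p q
    rw [inn]
    split_ifs with h
    · subst h
      rw [← h1 p.1 p.2]; congr 1; ext x; ring
    · exact haar_orth hs hl hr hz q p (Ne.symm h)
  have hb := ho.sum_inner_products_le F (s := t)
  have hF : ‖F‖ ^ 2 = ∫ x, (φ x) ^ 2 * v x := by
    rw [← real_inner_self_eq_norm_sq, inn]; congr 1; ext x; ring
  rw [hF] at hb
  refine le_trans (le_of_eq ?_) hb
  apply Finset.sum_congr rfl
  intro p _
  rw [inn, Real.norm_eq_abs, sq_abs]

lemma sum_AL_le {v : ℝ → ℝ} {H : ℤ → ℤ → ℝ → ℝ} {φ : ℝ → ℝ} {N : ℝ}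
    (hb : ∀ t : Finset (ℤ × ℤ), ∑ p ∈ t, (∫ x, φ x * H p.1 p.2 x * v x) ^ 2 ≤ N)
    (m : ℕ) (s : Finset (ℤ × ℤ)) : ∑ L ∈ s, AL v H m φ L.1 L.2 ≤ N := by
  unfold AL
  rw [Finset.sum_sigma' s
    (fun L => Finset.Ico ((2 : ℤ) ^ m * L.2) ((2 : ℤ) ^ m * (L.2 + 1)))]
  let g : (Σ _ : ℤ × ℤ, ℤ) → ℤ × ℤ := fun z => (z.1.1 + m, z.2)
  refine le_trans (le_of_eq ?_) (hb ((s.sigma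
    (fun L => Finset.Ico ((2 : ℤ) ^ m * L.2) ((2 : ℤ) ^ m * (L.2 + 1)))).image g))
  rw [Finset.sum_image]
  rintro ⟨⟨j, k⟩, i⟩ hz ⟨⟨j', k'⟩, i'⟩ hz' h
  simp only [Finset.coe_sigma, Set.mem_sigma_iff, Finset.mem_coe] at hz hz'
  simp only [g, Prod.mk.injEq] at h
  obtain ⟨ha, rfl⟩ := h
  have hk := ediv_eq_of_mem hz.2
  rw [ediv_eq_of_mem hz'.2] at hk
  have : j = j' := by omega
  subst this; subst hk; rfl

/-- `∑_L S_L(φw) S_L(ψσ) ≤ C [w]_{A₂}^{1/2} ‖φ‖_{L²(w)} ‖ψ‖_{L²(σ)}`. -/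
theorem sum_SL_SL_bound :
    ∃ C : ℝ, 0 < C ∧
      ∀ (m n : ℕ) (w : ℝ → ℝ), (∀ x, 0 < w x) → Measurable w →
        LocallyIntegrable w → LocallyIntegrable (fun x => (w x)⁻¹) →
      ∀ Q : ℝ, 1 ≤ Q →
        (∀ j k : ℤ, avg w j k * avg (fun x => (w x)⁻¹) j k ≤ Q) →
      ∀ hW : ℤ → ℤ → ℝ → ℝ, (∀ j k : ℤ, Measurable (hW j k)) →
        (∀ j k : ℤ, ∀ x ∉ dyad j k, hW j k x = 0) →
        (∀ j k : ℤ, ∀ x ∈ dyad (j + 1) (2 * k), ∀ y ∈ dyad (j + 1) (2 * k),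
          hW j k x = hW j k y) →
        (∀ j k : ℤ, ∀ x ∈ dyad (j + 1) (2 * k + 1), ∀ y ∈ dyad (j + 1) (2 * k + 1),
          hW j k x = hW j k y) →
        (∀ j k : ℤ, (∫ x, hW j k x * w x) = 0) →
        (∀ j k : ℤ, (∫ x, (hW j k x) ^ 2 * w x) = 1) →
      ∀ hS : ℤ → ℤ → ℝ → ℝ, (∀ j k : ℤ, Measurable (hS j k)) →
        (∀ j k : ℤ, ∀ x ∉ dyad j k, hS j k x = 0) →
        (∀ j k : ℤ, ∀ x ∈ dyad (j + 1) (2 * k), ∀ y ∈ dyad (j + 1) (2 * k),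
          hS j k x = hS j k y) →
        (∀ j k : ℤ, ∀ x ∈ dyad (j + 1) (2 * k + 1), ∀ y ∈ dyad (j + 1) (2 * k + 1),
          hS j k x = hS j k y) →
        (∀ j k : ℤ, (∫ x, hS j k x * (w x)⁻¹) = 0) →
        (∀ j k : ℤ, (∫ x, (hS j k x) ^ 2 * (w x)⁻¹) = 1) →
      ∀ φ ψ : ℝ → ℝ, Measurable φ → Measurable ψ →
        Integrable (fun x => (φ x) ^ 2 * w x) →
        Integrable (fun x => (ψ x) ^ 2 * (w x)⁻¹) →
        (∑' L : ℤ × ℤ,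
            ENNReal.ofReal (SL w hW m φ L.1 L.2 *
              SL (fun x => (w x)⁻¹) hS n ψ L.1 L.2))
          ≤ ENNReal.ofReal (C * Real.sqrt Q *
              Real.sqrt (∫ x, (φ x) ^ 2 * w x) *
              Real.sqrt (∫ x, (ψ x) ^ 2 * (w x)⁻¹)) := by
  refine ⟨1, one_pos, ?_⟩
  intro m n w w0 wm wl sl Q hQ hA hW a1 a2 a3 a4 a5 a6 hS b1 b2 b3 b4 b5 b6 φ ψ hφ hψ iφ iψ
  have s0 : ∀ x, 0 < (w x)⁻¹ := fun x => inv_pos.2 (w0 x)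
  have B1 := sum_AL_le (bessel w0 wm a1 a2 a3 a4 a5 a6 hφ iφ) m
  have B2 := sum_AL_le (bessel s0 wm.inv b1 b2 b3 b4 b5 b6 hψ iψ) n
  rw [ENNReal.tsum_eq_iSup_sum]
  refine iSup_le fun s => ?_
  rw [← ENNReal.ofReal_sum_of_nonneg
    (fun L _ => mul_nonneg (SL_nonneg _ _ _ _ _ _) (SL_nonneg _ _ _ _ _ _))]
  apply ENNReal.ofReal_le_ofReal
  have hnn1 : ∀ L : ℤ × ℤ, 0 ≤ AL w hW m φ L.1 L.2 :=
    fun L => Finset.sum_nonneg fun i _ => sq_nonneg _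
  have hnn2 : ∀ L : ℤ × ℤ, 0 ≤ AL (fun x => (w x)⁻¹) hS n ψ L.1 L.2 :=
    fun L => Finset.sum_nonneg fun i _ => sq_nonneg _
  calc ∑ L ∈ s, SL w hW m φ L.1 L.2 * SL (fun x => (w x)⁻¹) hS n ψ L.1 L.2
      ≤ ∑ L ∈ s, √Q * (√(AL w hW m φ L.1 L.2) * √(AL (fun x => (w x)⁻¹) hS n ψ L.1 L.2)) := by
        apply Finset.sum_le_sum
        intro L _
        refine (mul_le_mul (SL_le w0 wl hW m φ L.1 L.2) (SL_le s0 sl hS n ψ L.1 L.2)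
          (SL_nonneg _ _ _ _ _ _) (by positivity)).trans ?_
        have := Real.sqrt_le_sqrt (hA L.1 L.2)
        rw [Real.sqrt_mul (avg_nonneg' w0 _ _)] at this
        refine le_trans (le_of_eq ?_) (mul_le_mul_of_nonneg_right this
          (mul_nonneg (Real.sqrt_nonneg _) (Real.sqrt_nonneg _)))
        ring
    _ = √Q * ∑ L ∈ s, √(AL w hW m φ L.1 L.2) * √(AL (fun x => (w x)⁻¹) hS n ψ L.1 L.2) := by
        rw [Finset.mul_sum]
    _ ≤ √Q * (√(∫ x, (φ x) ^ 2 * w x) * √(∫ x, (ψ x) ^ 2 * (w x)⁻¹)) := by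
        apply mul_le_mul_of_nonneg_left _ (Real.sqrt_nonneg _)
        refine (Real.sum_sqrt_mul_sqrt_le s hnn1 hnn2).trans ?_
        exact mul_le_mul (Real.sqrt_le_sqrt (B1 s)) (Real.sqrt_le_sqrt (B2 s))
          (Real.sqrt_nonneg _) (Real.sqrt_nonneg _)
    _ = _ := by ring
end
end
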